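/- Let (E, ∘, ⟨·,·⟩) be a Euclidean Jordan algebra with symmetric cone K, let y ∈ E and z = y∘y. Let T_K(z) denote the tangent cone of the convex set K at z and lin T_K(z) = T_K(z) ∩ (−T_K(z)) its lineality space. Then (lin T_K(z))^⊥ ⊆ ker L_y = {w ∈ E : y∘w = 0}. If moreover y ∈ K, then also ker L_y ⊆ (lin T_K(z))^⊥, so the two sets are equal. -/

import Mathlib

open scoped RealInnerProductSpace

noncomputable section

/-- A Euclidean Jordan algebra structure on a finite-dimensional real inner
product space `E`: a commutative bilinear product `jmul` with unit, satisfying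
the Jordan identity and compatibility with the inner product, together with the
spectral theorem (every element has a spectral decomposition along a Jordan
frame of size `rank`) and the normalization `⟪c, c⟫ = 1` for primitive
idempotents, which encodes that the inner product is the trace form. -/
structure EJA (E : Type*) [NormedAddCommGroup E] [InnerProductSpace ℝ E]
    [FiniteDimensional ℝ E] where
  jmul : E →ₗ[ℝ] E →ₗ[ℝ] E
  comm : ∀ y z : E, jmul y z = jmul z y
  unit : E
  unit_jmul : ∀ y : E, jmul unit y = y
  jordan : ∀ y z : E, jmul y (jmul (jmul y y) z) = jmul (jmul y y) (jmul y z)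
  assoc_inner : ∀ y z w : E, ⟪jmul y z, w⟫ = ⟪y, jmul z w⟫
  rank : ℕ
  spectral : ∀ y : E, ∃ (c : Fin rank → E) (σ : Fin rank → ℝ),
    (∀ i, jmul (c i) (c i) = c i) ∧
    (∀ i, c i ≠ 0) ∧
    (∀ i, ∀ a b : E, jmul a a = a → jmul b b = b → a ≠ 0 → b ≠ 0 →
      jmul a b = 0 → c i ≠ a + b) ∧
    (∀ i j, i ≠ j → jmul (c i) (c j) = 0) ∧
    (∑ i, c i) = unit ∧
    y = ∑ i, σ i • c i
  inner_primitive : ∀ c : E, jmul c c = c → c ≠ 0 →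
    (∀ a b : E, jmul a a = a → jmul b b = b → a ≠ 0 → b ≠ 0 →
      jmul a b = 0 → c ≠ a + b) →
    ⟪c, c⟫ = 1

namespace EJA

variable {E : Type*} [NormedAddCommGroup E] [InnerProductSpace ℝ E]
  [FiniteDimensional ℝ E]

/-- `c` is an idempotent. -/
def IsIdempotent (J : EJA E) (c : E) : Prop := J.jmul c c = c

/-- `c` is a primitive idempotent. -/
def IsPrimitive (J : EJA E) (c : E) : Prop :=
  J.IsIdempotent c ∧ c ≠ 0 ∧
    ∀ a b : E, J.IsIdempotent a → J.IsIdempotent b → a ≠ 0 → b ≠ 0 →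
      J.jmul a b = 0 → c ≠ a + b

/-- A Jordan frame: primitive idempotents, pairwise orthogonal (w.r.t. the
Jordan product), summing to the unit. -/
def IsJordanFrame (J : EJA E) (c : Fin J.rank → E) : Prop :=
  (∀ i, J.IsPrimitive (c i)) ∧ (∀ i j, i ≠ j → J.jmul (c i) (c j) = 0) ∧
    (∑ i, c i) = J.unit

/-- The symmetric cone: the cone of squares of the algebra. -/
def K (J : EJA E) : Set E := {z : E | ∃ y : E, z = J.jmul y y}

/-- `y` has rank `k`: some spectral decomposition of `y` has exactly `k`
nonzero eigenvalues.  (By uniqueness of eigenvalues this is well-defined.) -/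
def HasRank (J : EJA E) (y : E) (k : ℕ) : Prop :=
  ∃ (c : Fin J.rank → E) (σ : Fin J.rank → ℝ),
    J.IsJordanFrame c ∧ y = ∑ i, σ i • c i ∧
      (Finset.univ.filter (fun i => σ i ≠ 0)).card = k

/-- `t` is an eigenvalue of `y`. -/
def IsEigenvalue (J : EJA E) (y : E) (t : ℝ) : Prop :=
  ∃ (c : Fin J.rank → E) (σ : Fin J.rank → ℝ) (i : Fin J.rank),
    J.IsJordanFrame c ∧ y = ∑ j, σ j • c j ∧ σ i = t

/-- `p` is a nearest point of the symmetric cone `K` to `v`. -/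
def IsProj (J : EJA E) (v p : E) : Prop :=
  p ∈ J.K ∧ ∀ z ∈ J.K, ‖v - p‖ ≤ ‖v - z‖

/-- A (linear subspace that is a) subalgebra. -/
def IsSubalgebra (J : EJA E) (V : Submodule ℝ E) : Prop :=
  ∀ a ∈ V, ∀ b ∈ V, J.jmul a b ∈ V

/-- The algebra is simple: it is not the direct sum of two nonzero
subalgebras. -/
def IsSimple (J : EJA E) : Prop :=
  ¬ ∃ V W : Submodule ℝ E, J.IsSubalgebra V ∧ J.IsSubalgebra W ∧
      V ≠ ⊥ ∧ W ≠ ⊥ ∧ V ⊓ W = ⊥ ∧ V ⊔ W = ⊤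

/-- The tangent cone of the convex set `K` at `z`:
the closure of `⋃_{t>0} t (K - z)`. -/
def tangentCone (J : EJA E) (z : E) : Set E :=
  closure {d : E | ∃ t : ℝ, 0 < t ∧ ∃ k ∈ J.K, d = t • (k - z)}

/-- The lineality space `T_K(z) ∩ (-T_K(z))` of the tangent cone. -/
def linTangent (J : EJA E) (z : E) : Set E :=
  {d : E | d ∈ J.tangentCone z ∧ -d ∈ J.tangentCone z}

/-- The Lagrangian of problem (P1):
`L(x, μ, λ) = f(x) - ⟪h(x), μ⟫ - ⟪g(x), λ⟫`. -/
def lagr {n m : ℕ} (f : EuclideanSpace ℝ (Fin n) → ℝ)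
    (h : EuclideanSpace ℝ (Fin n) → EuclideanSpace ℝ (Fin m))
    (g : EuclideanSpace ℝ (Fin n) → E) (μ : EuclideanSpace ℝ (Fin m)) (lam : E)
    (x : EuclideanSpace ℝ (Fin n)) : ℝ :=
  f x - ⟪h x, μ⟫ - ⟪g x, lam⟫

/-- The Lagrangian of the slack-variable problem (P2), as a function of the
pair `(x, y)`. -/
def lagrSlack (J : EJA E) {n m : ℕ} (f : EuclideanSpace ℝ (Fin n) → ℝ)
    (h : EuclideanSpace ℝ (Fin n) → EuclideanSpace ℝ (Fin m))
    (g : EuclideanSpace ℝ (Fin n) → E) (μ : EuclideanSpace ℝ (Fin m)) (lam : E)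
    (p : EuclideanSpace ℝ (Fin n) × E) : ℝ :=
  f p.1 - ⟪h p.1, μ⟫ - ⟪g p.1 - J.jmul p.2 p.2, lam⟫

/-- `(x, μ, lam)` is a KKT triple of problem (P1). -/
def KKTP1 (J : EJA E) {n m : ℕ} (f : EuclideanSpace ℝ (Fin n) → ℝ)
    (h : EuclideanSpace ℝ (Fin n) → EuclideanSpace ℝ (Fin m))
    (g : EuclideanSpace ℝ (Fin n) → E)
    (x : EuclideanSpace ℝ (Fin n)) (μ : EuclideanSpace ℝ (Fin m)) (lam : E) : Prop :=
  gradient f x - (fderiv ℝ h x).adjoint μ - (fderiv ℝ g x).adjoint lam = 0 ∧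
    lam ∈ J.K ∧ g x ∈ J.K ∧ J.jmul lam (g x) = 0 ∧ h x = 0

/-- `(x, y, μ, lam)` is a KKT quadruple of the slack-variable problem (P2). -/
def KKTP2 (J : EJA E) {n m : ℕ} (f : EuclideanSpace ℝ (Fin n) → ℝ)
    (h : EuclideanSpace ℝ (Fin n) → EuclideanSpace ℝ (Fin m))
    (g : EuclideanSpace ℝ (Fin n) → E)
    (x : EuclideanSpace ℝ (Fin n)) (y : E) (μ : EuclideanSpace ℝ (Fin m))
    (lam : E) : Prop :=
  gradient f x - (fderiv ℝ h x).adjoint μ - (fderiv ℝ g x).adjoint lam = 0 ∧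
    J.jmul lam y = 0 ∧ g x = J.jmul y y ∧ h x = 0

/-- The augmented Lagrangian of the slack-variable problem (P2). -/
def augSlack (J : EJA E) {n m : ℕ} (f : EuclideanSpace ℝ (Fin n) → ℝ)
    (h : EuclideanSpace ℝ (Fin n) → EuclideanSpace ℝ (Fin m))
    (g : EuclideanSpace ℝ (Fin n) → E) (ρ : ℝ) (μ : EuclideanSpace ℝ (Fin m))
    (lam : E) (x : EuclideanSpace ℝ (Fin n)) (y : E) : ℝ :=
  f x - ⟪h x, μ⟫ + ρ / 2 * ‖h x‖ ^ 2 - ⟪g x - J.jmul y y, lam⟫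
    + ρ / 2 * ‖g x - J.jmul y y‖ ^ 2

/-- The augmented Lagrangian of problem (P1), where `P` is the metric
projection onto the symmetric cone `K`. -/
def augSym (J : EJA E) {n m : ℕ} (f : EuclideanSpace ℝ (Fin n) → ℝ)
    (h : EuclideanSpace ℝ (Fin n) → EuclideanSpace ℝ (Fin m))
    (g : EuclideanSpace ℝ (Fin n) → E) (P : E → E) (ρ : ℝ)
    (μ : EuclideanSpace ℝ (Fin m)) (lam : E)
    (x : EuclideanSpace ℝ (Fin n)) : ℝ :=
  f x - ⟪h x, μ⟫ + ρ / 2 * ‖h x‖ ^ 2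
    + 1 / (2 * ρ) * (-‖lam‖ ^ 2 + ‖P (lam - ρ • g x)‖ ^ 2)

end EJA

namespace EJA

variable {E : Type*} [NormedAddCommGroup E] [InnerProductSpace ℝ E]
  [FiniteDimensional ℝ E]

/-- The linearized Jordan identity. -/
lemma jordan_linearized (J : EJA E) (y v z : E) :
    J.jmul v (J.jmul (J.jmul y y) z) + (2 : ℝ) • J.jmul y (J.jmul (J.jmul y v) z) =
      J.jmul (J.jmul y y) (J.jmul v z) + (2 : ℝ) • J.jmul (J.jmul y v) (J.jmul y z) := by
  have h1 := J.jordan (y + v) z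
  have h2 := J.jordan (y - v) z
  have h3 := J.jordan v z
  simp only [map_add, map_sub, LinearMap.add_apply, LinearMap.sub_apply, J.comm v y] at h1 h2
  linear_combination (norm := module) (1 / 2 : ℝ) • h1 - (1 / 2 : ℝ) • h2 - h3

/-- The Peirce polynomial annihilates multiplication by an idempotent. -/
lemma IsIdempotent.peirce {J : EJA E} {c : E} (hc : J.IsIdempotent c) (v : E) :
    (2 : ℝ) • J.jmul c (J.jmul c (J.jmul c v)) + J.jmul c v =
      (3 : ℝ) • J.jmul c (J.jmul c v) := by
  have h := J.jordan_linearized c v c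
  have hc' : J.jmul c c = c := hc
  rw [J.comm (J.jmul c v) c, hc', hc', J.comm v c, J.comm (J.jmul c v) c] at h
  linear_combination (norm := module) h

lemma inner_jmul_left (J : EJA E) (y v w : E) : ⟪J.jmul y v, w⟫ = ⟪v, J.jmul y w⟫ := by
  rw [J.comm, J.assoc_inner]

/-- Multiplication by an idempotent is positive semidefinite. -/
lemma IsIdempotent.inner_jmul_self_nonneg {J : EJA E} {c : E} (hc : J.IsIdempotent c) (v : E) :
    0 ≤ ⟪J.jmul c v, v⟫ := by
  set a := J.jmul c v with ha
  set b := J.jmul c a with hb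
  set d := J.jmul c b with hd
  have hp : (2 : ℝ) • d + a = (3 : ℝ) • b := hc.peirce v
  have hp' : (2 : ℝ) • J.jmul c d + b = (3 : ℝ) • d := hc.peirce a
  have haa : ⟪a, a⟫ = ⟪b, v⟫ := (J.inner_jmul_left c a v).symm
  have hab : ⟪b, a⟫ = ⟪d, v⟫ := (J.inner_jmul_left c b v).symm
  have hbb : ⟪b, b⟫ = ⟪J.jmul c d, v⟫ :=
    (J.inner_jmul_left c b a).symm.trans (J.inner_jmul_left c d v).symm
  have e1 := congrArg (fun x => ⟪x, v⟫) hp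
  have e2 := congrArg (fun x => ⟪x, v⟫) hp'
  simp only [inner_add_left, real_inner_smul_left] at e1 e2
  have hsq : 0 ≤ ⟪b - a, b - a⟫ := real_inner_self_nonneg
  rw [inner_sub_left, inner_sub_right, inner_sub_right, real_inner_comm b a] at hsq
  have haa0 : 0 ≤ ⟪a, a⟫ := real_inner_self_nonneg
  linarith

lemma IsIdempotent.inner_nonneg {J : EJA E} {c k : E} (hc : J.IsIdempotent c) (hk : k ∈ J.K) :
    0 ≤ ⟪c, k⟫ := by
  obtain ⟨b, rfl⟩ := hk
  rw [← J.assoc_inner]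
  exact hc.inner_jmul_self_nonneg b

/-- Spectral decomposition along orthogonal idempotents, together with that of the square. -/
lemma exists_spectral (J : EJA E) (y : E) : ∃ (c : Fin J.rank → E) (σ : Fin J.rank → ℝ),
    (∀ i, J.IsIdempotent (c i)) ∧ y = ∑ i, σ i • c i ∧
      J.jmul y y = ∑ i, σ i ^ 2 • c i ∧
      J.jmul (J.jmul y y) (J.jmul y y) = ∑ i, (σ i ^ 2) ^ 2 • c i := by
  obtain ⟨c, σ, hc, -, -, ho, -, hy⟩ := J.spectral y
  have hsq : ∀ τ : Fin J.rank → ℝ,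
      J.jmul (∑ i, τ i • c i) (∑ i, τ i • c i) = ∑ i, τ i ^ 2 • c i := by
    intro τ
    simp only [map_sum, LinearMap.sum_apply, map_smul, LinearMap.smul_apply]
    refine Finset.sum_congr rfl fun i _ => ?_
    rw [Finset.sum_eq_single i]
    · rw [hc, smul_smul, pow_two]
    · intro j _ hj
      simp [ho _ _ hj]
    · simp
  have hyy : J.jmul y y = ∑ i, σ i ^ 2 • c i := by rw [hy, hsq]
  exact ⟨c, σ, hc, hy, hyy, by rw [hyy, hsq]⟩

/-- An idempotent orthogonal to `y ∈ K` is orthogonal to `y ∘ y`. -/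
lemma IsIdempotent.inner_sq_eq_zero {J : EJA E} {d y : E} (hd : J.IsIdempotent d)
    (hy : y ∈ J.K) (h : ⟪d, y⟫ = 0) : ⟪d, J.jmul y y⟫ = 0 := by
  obtain ⟨a, rfl⟩ := hy
  obtain ⟨c, σ, hc, -, h1, h2⟩ := J.exists_spectral a
  have hn : ∀ i, 0 ≤ ⟪d, c i⟫ := fun i => hd.inner_nonneg ⟨c i, (hc i).symm⟩
  rw [h1, inner_sum, Finset.sum_eq_zero_iff_of_nonneg
    fun i _ => by rw [real_inner_smul_right]; exact mul_nonneg (sq_nonneg _) (hn i)] at h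
  rw [h2, inner_sum]
  refine Finset.sum_eq_zero fun i hi => ?_
  have := h i hi
  rw [real_inner_smul_right] at this ⊢
  rw [pow_two (σ i ^ 2), mul_assoc, this, mul_zero]

/-- An element nonnegative on `K` and orthogonal to `z` is nonnegative on the tangent cone. -/
lemma inner_nonneg_of_mem_tangentCone {J : EJA E} {d z u : E} (hd : ∀ k ∈ J.K, 0 ≤ ⟪d, k⟫)
    (hz : ⟪d, z⟫ = 0) (hu : u ∈ J.tangentCone z) : 0 ≤ ⟪d, u⟫ := by
  have hcl : IsClosed {u : E | 0 ≤ ⟪d, u⟫} :=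
    isClosed_le continuous_const (continuous_const.inner continuous_id)
  refine closure_minimal ?_ hcl hu
  rintro _ ⟨t, ht, k, hk, rfl⟩
  rw [Set.mem_ofPred_eq, real_inner_smul_right, inner_sub_right, hz, sub_zero]
  exact mul_nonneg ht.le (hd k hk)

lemma inner_eq_zero_of_mem_linTangent {J : EJA E} {d z u : E} (hd : ∀ k ∈ J.K, 0 ≤ ⟪d, k⟫)
    (hz : ⟪d, z⟫ = 0) (hu : u ∈ J.linTangent z) : ⟪d, u⟫ = 0 := by
  have h1 := inner_nonneg_of_mem_tangentCone hd hz hu.1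
  have h2 := inner_nonneg_of_mem_tangentCone hd hz hu.2
  rw [inner_neg_right] at h2
  linarith

/-- The derivative of squaring at `y` takes values in the tangent cone at `y ∘ y`. -/
lemma two_smul_jmul_mem_tangentCone (J : EJA E) (y v : E) :
    (2 : ℝ) • J.jmul y v ∈ J.tangentCone (J.jmul y y) := by
  have hcont : Continuous fun t : ℝ => (2 : ℝ) • J.jmul y v + t • J.jmul v v := by fun_prop
  have hlim : Filter.Tendsto (fun t : ℝ => (2 : ℝ) • J.jmul y v + t • J.jmul v v)
      (nhdsWithin 0 (Set.Ioi 0)) (nhds ((2 : ℝ) • J.jmul y v)) := by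
    simpa using (hcont.tendsto 0).mono_left nhdsWithin_le_nhds
  refine mem_closure_of_tendsto hlim ?_
  filter_upwards [self_mem_nhdsWithin] with t ht
  have ht0 : (0 : ℝ) < t := ht
  refine ⟨t⁻¹, inv_pos.mpr ht0, _, ⟨y + t • v, rfl⟩, ?_⟩
  simp only [map_add, map_smul, LinearMap.add_apply, LinearMap.smul_apply, J.comm v y]
  rw [eq_inv_smul_iff₀ ht0.ne']
  module

lemma two_smul_jmul_mem_linTangent (J : EJA E) (y v : E) :
    (2 : ℝ) • J.jmul y v ∈ J.linTangent (J.jmul y y) := by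
  refine ⟨J.two_smul_jmul_mem_tangentCone y v, ?_⟩
  simpa using J.two_smul_jmul_mem_tangentCone y (-v)

end EJA

/-- for `z = y∘y`, `(lin T_K(z))^⊥ ⊆ ker L_y`, with equality
when `y ∈ K`. -/
theorem stmt12 {E : Type*} [NormedAddCommGroup E] [InnerProductSpace ℝ E]
    [FiniteDimensional ℝ E] (J : EJA E) (y z : E) (hz : z = J.jmul y y) :
    (∀ w : E, (∀ u ∈ J.linTangent z, ⟪w, u⟫ = 0) → J.jmul y w = 0) ∧
      (y ∈ J.K → ∀ w : E, J.jmul y w = 0 →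
        ∀ u ∈ J.linTangent z, ⟪w, u⟫ = 0) := by
  subst hz
  refine ⟨fun w hw => ?_, fun hy w hw u hu => ?_⟩
  · have h := hw _ (J.two_smul_jmul_mem_linTangent y (J.jmul y w))
    rw [real_inner_smul_right, ← J.inner_jmul_left] at h
    exact inner_self_eq_zero.mp (by linarith : ⟪J.jmul y w, J.jmul y w⟫ = 0)
  · obtain ⟨d, μ, hd, hw1, hw2, -⟩ := J.exists_spectral w
    have h0 : ⟪J.jmul w w, y⟫ = 0 := by rw [J.assoc_inner, J.comm w y, hw, inner_zero_right]
    rw [hw2, sum_inner, Finset.sum_eq_zero_iff_of_nonneg fun i _ => by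
      rw [real_inner_smul_left]
      exact mul_nonneg (sq_nonneg _) ((hd i).inner_nonneg hy)] at h0
    rw [hw1, sum_inner]
    refine Finset.sum_eq_zero fun i hi => ?_
    have hi0 := h0 i hi
    rw [real_inner_smul_left, mul_eq_zero] at hi0 ⊢
    refine hi0.imp (fun h => pow_eq_zero_iff two_ne_zero |>.mp h) fun h => ?_
    exact EJA.inner_eq_zero_of_mem_linTangent (fun k hk => (hd i).inner_nonneg hk)
      ((hd i).inner_sq_eq_zero hy h) hu
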